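/- arXiv:2405.02789 — 2 statements merged into one kernel-verified Lean document; each statement's English description precedes it below -/
import Mathlib

section
/- Let X = 𝕋² be the 2-dimensional torus and let G = {x ∈ X : x + x = 0} be the subgroup generated by all elements of order 2. Then there exist a topological automorphism α of 𝕋² with Ker(I+α) = {0} (i.e., x + αx = 0 implies x = 0) and independent 𝕋²-valued random variables ξ₁, ξ₂ with distributions μ₁, μ₂ whose characteristic functions do not vanish, such that the joint distribution of (ξ₁+ξ₂, ξ₁+αξ₂) equals the joint distribution of (ξ₁+ξ₂, −(ξ₁+αξ₂)) (i.e., the conditional distribution of L₂ = ξ₁+αξ₂ given L₁ = ξ₁+ξ₂ is symmetric), while for j = 1, 2 there exist no Gaussian distribution γ on 𝕋² and no probability measure ω supported in G with μⱼ = γ ∗ ω. -/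
open MeasureTheory ProbabilityTheory

noncomputable section

/-- The circle group `𝕋 = ℝ/ℤ`. -/
abbrev Torus : Type := AddCircle (1 : ℝ)

/-- The 2-dimensional torus `𝕋² = 𝕋 × 𝕋`. -/
abbrev TwoTorus : Type := Torus × Torus

/-- The character group of `X`: continuous homomorphisms into the circle group. -/
abbrev CharGroup (X : Type*) [AddCommGroup X] [TopologicalSpace X] : Type _ :=
  ContinuousAddMonoidHom X Torus

/-- The characteristic function (Fourier transform) of a measure `μ` on `X`,
evaluated at the character `y`. -/
def charFun' {X : Type*} [AddCommGroup X] [TopologicalSpace X] [MeasurableSpace X]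
    (μ : Measure X) (y : CharGroup X) : ℂ :=
  ∫ x, (AddCircle.toCircle (y x) : ℂ) ∂μ

/-- A probability measure `γ` on `X` is Gaussian if its characteristic function has the form
`γ̂(y) = (x₀,y)·exp(−φ(y))` with `φ` continuous, nonnegative and quadratic. -/
def IsGaussianMeasure {X : Type*} [AddCommGroup X] [TopologicalSpace X] [MeasurableSpace X]
    (γ : Measure X) : Prop :=
  IsProbabilityMeasure γ ∧
  ∃ (x₀ : X) (φ : CharGroup X → ℝ), Continuous φ ∧ (∀ y, 0 ≤ φ y) ∧
    (∀ u v, φ (u + v) + φ (u - v) = 2 * (φ u + φ v)) ∧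
    ∀ y : CharGroup X, charFun' γ y = (AddCircle.toCircle (y x₀) : ℂ) * Complex.exp (-(φ y : ℂ))

section Characters

variable {X : Type*} [AddCommGroup X] [TopologicalSpace X]

/-- A character regarded as a continuous complex-valued function. -/
def charMap (y : CharGroup X) : C(X, ℂ) :=
  ⟨fun x => (AddCircle.toCircle (y x) : ℂ),
    continuous_subtype_val.comp (AddCircle.continuous_toCircle.comp y.continuous_toFun)⟩

@[simp] lemma charMap_apply (y : CharGroup X) (x : X) :
    charMap y x = (AddCircle.toCircle (y x) : ℂ) := rfl

lemma charMap_zero : charMap (0 : CharGroup X) = 1 := by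
  ext x
  have : (0 : CharGroup X) x = 0 := rfl
  simp [this]

lemma charMap_add (y z : CharGroup X) : charMap (y + z) = charMap y * charMap z := by
  ext x; simp [ContinuousAddMonoidHom.add_apply, AddCircle.toCircle_add]

lemma charMap_neg (y : CharGroup X) : charMap (-y) = star (charMap y) := by
  ext x
  have : (-y) x = -(y x) := rfl
  simp [this, AddCircle.toCircle_neg, ← Circle.coe_inv_eq_conj]

lemma norm_charMap_apply (y : CharGroup X) (x : X) : ‖charMap y x‖ = 1 := Circle.norm_coe _

/-- The star subalgebra of trigonometric polynomials with frequencies in `H`. -/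
def trigPoly (H : AddSubgroup (CharGroup X)) : StarSubalgebra ℂ C(X, ℂ) where
  toSubalgebra := Algebra.adjoin ℂ (charMap '' H)
  star_mem' := by
    change Algebra.adjoin ℂ (charMap '' (H : Set (CharGroup X))) ≤
      star (Algebra.adjoin ℂ (charMap '' (H : Set (CharGroup X))))
    refine Algebra.adjoin_le ?_
    rintro _ ⟨y, hy, rfl⟩
    exact Algebra.subset_adjoin ⟨-y, H.neg_mem hy, charMap_neg y⟩

lemma trigPoly_coe (H : AddSubgroup (CharGroup X)) :
    Subalgebra.toSubmodule (trigPoly H).toSubalgebra = Submodule.span ℂ (charMap '' H) := by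
  apply Algebra.adjoin_eq_span_of_subset
  refine Set.Subset.trans ?_ Submodule.subset_span
  intro f hf
  refine Submonoid.closure_induction (fun _ => id) ⟨0, H.zero_mem, charMap_zero⟩ ?_ hf
  rintro _ _ _ _ ⟨y, hy, rfl⟩ ⟨z, hz, rfl⟩
  exact ⟨y + z, H.add_mem hy hz, charMap_add y z⟩

lemma toCircle_injective : Function.Injective (AddCircle.toCircle : Torus → Circle) :=
  AddCircle.injective_toCircle one_ne_zero

lemma dense_span_charMap [CompactSpace X] (H : AddSubgroup (CharGroup X))
    (hH : ∀ x : X, x ≠ 0 → ∃ y ∈ H, y x ≠ 0) :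
    (Submodule.span ℂ (charMap '' (H : Set (CharGroup X)))).topologicalClosure = ⊤ := by
  have hsep : (trigPoly H).SeparatesPoints := by
    intro a b hab
    obtain ⟨y, hy, hne⟩ := hH (a - b) (sub_ne_zero.2 hab)
    refine ⟨_, ⟨charMap y, Algebra.subset_adjoin ⟨y, hy, rfl⟩, rfl⟩, fun h => hne ?_⟩
    have h2 : y a = y b := toCircle_injective (Subtype.ext h)
    rw [map_sub, h2, sub_self]
  rw [← trigPoly_coe]
  exact congr_arg (Subalgebra.toSubmodule <| StarSubalgebra.toSubalgebra ·)
    (ContinuousMap.starSubalgebra_topologicalClosure_eq_top_of_separatesPoints _ hsep)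

variable [MeasurableSpace X]

lemma charFun'_eq (μ : Measure X) (y : CharGroup X) : charFun' μ y = ∫ x, charMap y x ∂μ := rfl

lemma charFun'_zero (μ : Measure X) : charFun' μ 0 = μ.real Set.univ := by
  simp [charFun'_eq, charMap_zero]

variable [BorelSpace X]

/-- Integration against a finite measure, as a continuous linear functional on `C(X, ℂ)`. -/
def integralFunctional [CompactSpace X] (μ : Measure X) [IsFiniteMeasure μ] : C(X, ℂ) →L[ℂ] ℂ :=
  LinearMap.mkContinuous
    { toFun := fun f => ∫ x, f x ∂μ
      map_add' := fun f g => integral_add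
        (f.continuous.integrable_of_hasCompactSupport (HasCompactSupport.of_compactSpace _))
        (g.continuous.integrable_of_hasCompactSupport (HasCompactSupport.of_compactSpace _))
      map_smul' := fun c f => integral_smul c f } (μ.real Set.univ) fun f => by
    rw [mul_comm]
    exact norm_integral_le_of_norm_le_const (.of_forall f.norm_coe_le_norm)

/-- A finite measure is determined by its characteristic function. -/
lemma ext_of_charFun'_eq [CompactSpace X] [HasOuterApproxClosed X]
    (hX : ∀ x : X, x ≠ 0 → ∃ y : CharGroup X, y x ≠ 0) {μ ν : Measure X} [IsFiniteMeasure μ]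
    [IsFiniteMeasure ν] (h : ∀ y, charFun' μ y = charFun' ν y) : μ = ν := by
  have hd := dense_span_charMap (X := X) ⊤ (by simpa using hX)
  have heq : integralFunctional μ = integralFunctional ν := by
    refine ContinuousLinearMap.ext_on ((Submodule.dense_iff_topologicalClosure_eq_top).2 hd) ?_
    rintro _ ⟨y, -, rfl⟩
    exact h y
  refine ext_of_forall_integral_eq_of_IsFiniteMeasure fun f => ?_
  have : ∫ x, (f x : ℂ) ∂μ = ∫ x, (f x : ℂ) ∂ν :=
    DFunLike.congr_fun heq ⟨fun x => (f x : ℂ), by fun_prop⟩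
  simpa [integral_complex_ofReal] using this

section Haar

variable [IsTopologicalAddGroup X] (ν : Measure X) [ν.IsAddLeftInvariant]

lemma charFun'_eq_zero_of_ne_zero {y : CharGroup X} (hy : y ≠ 0) : charFun' ν y = 0 := by
  obtain ⟨a, ha⟩ : ∃ a, y a ≠ 0 := by
    by_contra! h
    exact hy (ContinuousAddMonoidHom.ext h)
  have h1 : charFun' ν y = (AddCircle.toCircle (y a) : ℂ) * charFun' ν y := by
    conv_lhs => rw [charFun', ← integral_add_left_eq_self _ a]
    rw [charFun', ← integral_const_mul]
    simp [AddCircle.toCircle_add]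
  have h2 : (AddCircle.toCircle (y a) : ℂ) ≠ 1 := fun h => ha <| toCircle_injective <| by
    rw [AddCircle.toCircle_zero]; exact Subtype.ext h
  by_contra h
  exact h2 (mul_right_cancel₀ h (by rw [one_mul, ← h1]))

include ν in
/-- A subgroup of characters of a compact group which separates points contains every
character. -/
lemma mem_of_separates [CompactSpace X] [IsProbabilityMeasure ν] (H : AddSubgroup (CharGroup X))
    (hH : ∀ x : X, x ≠ 0 → ∃ y ∈ H, y x ≠ 0) (y : CharGroup X) : y ∈ H := by
  by_contra hy
  have h0 : (integralFunctional ν).comp (ContinuousLinearMap.mul ℂ C(X, ℂ) (charMap (-y))) = 0 := by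
    refine ContinuousLinearMap.ext_on
      ((Submodule.dense_iff_topologicalClosure_eq_top).2 (dense_span_charMap H hH)) ?_
    rintro _ ⟨z, hz, rfl⟩
    have : -y + z ≠ 0 := fun h => hy (by rwa [neg_add_eq_zero.1 h])
    have := charFun'_eq_zero_of_ne_zero ν this
    rwa [charFun'_eq, charMap_add] at this
  have h1 : ∫ x, (charMap (-y) * charMap y) x ∂ν = 0 :=
    DFunLike.congr_fun h0 (charMap y)
  rw [← charMap_add, neg_add_cancel, ← charFun'_eq, charFun'_zero] at h1
  simp at h1

/-- A nonnegative even function `c` with `c 0 = 1` and sum at most `2` on a subgroup of the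
character group is the restriction of a characteristic function: the Fourier series with
coefficients `c` is a nonnegative density. -/
lemma exists_probabilityMeasure_charFun'_eq [CompactSpace X] [IsProbabilityMeasure ν] {ι : Type*}
    [AddCommGroup ι] {e : ι →+ CharGroup X} (he : Function.Injective e) {c : ι → ℝ}
    (h0 : c 0 = 1) (hpos : ∀ p, 0 ≤ c p) (heven : ∀ p, c (-p) = c p) (hc : Summable c)
    (hsum : ∑' p, c p ≤ 2) :
    ∃ μ : Measure X, IsProbabilityMeasure μ ∧ ∀ p, charFun' μ (e p) = c p := by
  have hsm : Summable fun p => (c p : ℂ) • charMap (e p) := by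
    refine .of_norm_bounded hc fun p => ?_
    rw [ContinuousMap.norm_le _ (hpos p)]
    intro x
    rw [ContinuousMap.smul_apply, norm_smul, norm_charMap_apply, mul_one, Complex.norm_real,
      Real.norm_of_nonneg (hpos p)]
  set F : C(X, ℂ) := ∑' p, (c p : ℂ) • charMap (e p) with hF
  have hFx (x : X) : HasSum (fun p => (c p : ℂ) * charMap (e p) x) (F x) :=
    hsm.hasSum.mapL (ContinuousMap.evalCLM ℂ x)
  have hreal (x : X) : (((F x).re : ℝ) : ℂ) = F x := by
    rw [← Complex.conj_eq_iff_re]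
    have h1 := (Equiv.neg ι).hasSum_iff.2 (hFx x)
    refine HasSum.unique ?_ h1
    convert (hFx x).map (starRingEnd ℂ) Complex.continuous_conj using 1
    ext p
    simp [heven, charMap_neg, -charMap_apply]
  have hnonneg (x : X) : 0 ≤ (F x).re := by
    classical
    have h1 : HasSum (fun p => (Pi.single (0 : ι) (2 : ℝ) : ι → ℝ) p - c p) (2 - ∑' p, c p) :=
      (hasSum_pi_single 0 (2 : ℝ)).sub hc.hasSum
    have h2 := Complex.hasSum_re (hFx x)
    refine (sub_nonneg.2 hsum).trans (hasSum_le (fun p => ?_) h1 h2)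
    rw [Complex.re_ofReal_mul]
    by_cases hp : p = 0
    · subst hp
      simp [h0, charMap_zero, -charMap_apply]
      norm_num
    · have h3 : -1 ≤ (charMap (e p) x).re := by
        have := (abs_le.1 (Complex.abs_re_le_norm (charMap (e p) x))).1
        rwa [norm_charMap_apply] at this
      rw [Pi.single_eq_of_ne hp]
      nlinarith [hpos p]
  have hFc : Continuous fun x => (F x).re := Complex.continuous_re.comp F.continuous
  have hint : Integrable (fun x => (F x).re) ν :=
    hFc.integrable_of_hasCompactSupport (HasCompactSupport.of_compactSpace _)
  have hfin := isFiniteMeasure_withDensity_ofReal hint.2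
  have hcoef (q : ι) :
      charFun' (ν.withDensity fun x => ENNReal.ofReal (F x).re) (e q) = c q := by
    rw [charFun'_eq, integral_withDensity_eq_integral_toReal_smul
      (by fun_prop) (by simp)]
    have h1 : HasSum (fun p => (c p : ℂ) * charFun' ν (e (q + p)))
        (∫ x, (charMap (e q) * F) x ∂ν) := by
      have := hsm.hasSum.mapL
        ((integralFunctional ν).comp (ContinuousLinearMap.mul ℂ C(X, ℂ) (charMap (e q))))
      rw [← hF] at this
      convert this using 2 with p
      · rw [map_add, charFun'_eq, charMap_add, map_smul, smul_eq_mul]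
        rfl
      · rfl
    have h2 := hasSum_single (f := fun p => (c p : ℂ) * charFun' ν (e (q + p))) (-q) fun p hp => by
      rw [charFun'_eq_zero_of_ne_zero ν, mul_zero]
      rw [Ne, map_eq_zero_iff _ he]
      exact fun h => hp (neg_eq_of_add_eq_zero_right h).symm
    have h3 := h1.unique h2
    rw [add_neg_cancel, map_zero, charFun'_zero, heven] at h3
    simp only [probReal_univ, Complex.ofReal_one, mul_one] at h3
    rw [← h3]
    congr with x
    rw [ENNReal.toReal_ofReal (hnonneg x), Complex.real_smul, hreal, mul_comm]
    rfl
  refine ⟨_, ⟨?_⟩, hcoef⟩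
  have h1 := hcoef 0
  rw [map_zero, charFun'_zero, h0, Complex.ofReal_inj] at h1
  rwa [measureReal_def, ENNReal.toReal_eq_one_iff] at h1

end Haar

end Characters

section Decomposition

variable {X : Type*} [AddCommGroup X] [TopologicalSpace X] [MeasurableSpace X]

lemma norm_charFun'_le_one (μ : Measure X) [IsProbabilityMeasure μ] (y : CharGroup X) :
    ‖charFun' μ y‖ ≤ 1 := by
  simpa [charFun'_eq] using norm_integral_le_of_norm_le_const (μ := μ) (.of_forall fun x =>
    (norm_charMap_apply y x).le)

lemma charFun'_add_self_of_two_torsion (ω : Measure X) [IsProbabilityMeasure ω]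
    (hω : ω {x : X | x + x = 0} = 1) (hm : MeasurableSet {x : X | x + x = 0}) (y : CharGroup X) :
    charFun' ω (y + y) = 1 := by
  have hae : ∀ᵐ x ∂ω, x + x = 0 := (prob_compl_eq_zero_iff hm).2 hω
  have h : charMap (y + y) =ᵐ[ω] fun _ => 1 := by
    filter_upwards [hae] with x hx
    have : (y + y) x = 0 := by
      change y x + y x = 0
      rw [← map_add, hx, map_zero]
    simp [this]
  rw [charFun'_eq, integral_congr_ae h]
  simp

variable [BorelSpace X]

lemma integrable_charMap (μ : Measure X) [IsFiniteMeasure μ] (y : CharGroup X) :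
    Integrable (charMap y) μ :=
  .of_bound (charMap y).continuous.measurable.aestronglyMeasurable 1
    (.of_forall fun x => (norm_charMap_apply y x).le)

lemma charFun'_conv [MeasurableAdd₂ X] (μ ν : Measure X) [IsFiniteMeasure μ] [IsFiniteMeasure ν]
    (y : CharGroup X) : charFun' (μ ∗ ν) y = charFun' μ y * charFun' ν y := by
  rw [charFun'_eq, integral_conv (integrable_charMap _ y)]
  simp [charFun', AddCircle.toCircle_add, integral_const_mul, integral_mul_const]

/-- On the subgroup of even characters the convolution of a Gaussian distribution with a
distribution of `2`-torsion elements has the modulus of the Gaussian, so at every other character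
its modulus is at most that of the Gaussian. -/
lemma norm_charFun'_pow_four_le [T1Space X] [ContinuousAdd X] [MeasurableAdd₂ X]
    {γ ω : Measure X} (hγ : IsGaussianMeasure γ) [IsProbabilityMeasure ω]
    (hω : ω {x : X | x + x = 0} = 1) (y : CharGroup X) :
    ‖charFun' (γ ∗ ω) y‖ ^ 4 ≤ ‖charFun' (γ ∗ ω) (y + y)‖ := by
  obtain ⟨hprob, x₀, φ, -, -, hφ, hγφ⟩ := hγ
  have hnorm (z : CharGroup X) : ‖charFun' γ z‖ = Real.exp (-φ z) := by
    rw [hγφ, norm_mul, Circle.norm_coe, one_mul, ← Complex.ofReal_neg, Complex.norm_exp_ofReal]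
  have hm : MeasurableSet {x : X | x + x = 0} :=
    (isClosed_singleton.preimage (continuous_id.add continuous_id)).measurableSet
  have h0 : φ 0 = 0 := by
    have := hφ 0 0
    rw [add_zero, sub_zero] at this
    linarith
  have h2 : φ (y + y) = 4 * φ y := by
    have := hφ y y
    rw [sub_self, h0] at this
    linarith
  rw [charFun'_conv, charFun'_conv, charFun'_add_self_of_two_torsion ω hω hm, mul_one, norm_mul,
    hnorm, hnorm, mul_pow, h2, ← Real.exp_nat_mul]
  calc _ ≤ Real.exp ((4 : ℕ) * -φ y) * 1 := by
        gcongr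
        exact pow_le_one₀ (norm_nonneg _) (norm_charFun'_le_one ω y)
    _ = _ := by
        rw [mul_one]
        congr 1
        push_cast
        ring

end Decomposition

section Joint

variable {X : Type*} [AddCommGroup X] [TopologicalSpace X] [MeasurableSpace X] [BorelSpace X]
  [SecondCountableTopology X] [IsTopologicalAddGroup X]

lemma charFun'_map_linearForms (μ₁ μ₂ : Measure X) [IsFiniteMeasure μ₁] [IsFiniteMeasure μ₂]
    (a b : X →ₜ+ X) (w : CharGroup (X × X)) :
    charFun' ((μ₁.prod μ₂).map fun p => (p.1 + p.2, a p.1 + b p.2)) w =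
      charFun' μ₁ (w.comp (.inl X X) + (w.comp (.inr X X)).comp a) *
        charFun' μ₂ (w.comp (.inl X X) + (w.comp (.inr X X)).comp b) := by
  have ha := a.continuous_toFun
  have hb := b.continuous_toFun
  have hc : Continuous fun p : X × X => (p.1 + p.2, a p.1 + b p.2) :=
    (continuous_fst.add continuous_snd).prodMk
      ((ha.comp continuous_fst).add (hb.comp continuous_snd))
  rw [charFun'_eq, integral_map hc.aemeasurable
    (charMap w).continuous.measurable.aestronglyMeasurable, charFun'_eq, charFun'_eq,
    ← integral_prod_mul]
  congr with p
  have h : (p.1 + p.2, a p.1 + b p.2) =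
      ((p.1, 0) + (0, a p.1)) + ((p.2, 0) + (0, b p.2)) := by ext <;> simp
  rw [charMap_apply, h, map_add, map_add, map_add]
  simp only [AddCircle.toCircle_add, Circle.coe_mul, charMap_add]
  rfl

end Joint

section Torus

/-- The character `(x₁, x₂) ↦ n x₁ + m x₂` of the two-dimensional torus. -/
def torusChar : ℤ × ℤ →+ CharGroup TwoTorus where
  toFun p := p.1 • ContinuousAddMonoidHom.fst Torus Torus +
    p.2 • ContinuousAddMonoidHom.snd Torus Torus
  map_zero' := by simp
  map_add' p q := by
    rw [Prod.fst_add, Prod.snd_add, add_zsmul, add_zsmul]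
    exact add_add_add_comm _ _ _ _

lemma zsmul_charGroup_apply {X : Type*} [AddCommGroup X] [TopologicalSpace X] (n : ℤ)
    (y : CharGroup X) (x : X) : (n • y) x = n • y x :=
  map_zsmul (⟨⟨fun y => y x, rfl⟩, fun _ _ => rfl⟩ : CharGroup X →+ Torus) n y

@[simp] lemma torusChar_apply (p : ℤ × ℤ) (x : TwoTorus) :
    torusChar p x = p.1 • x.1 + p.2 • x.2 := by
  change (p.1 • ContinuousAddMonoidHom.fst Torus Torus) x +
    (p.2 • ContinuousAddMonoidHom.snd Torus Torus) x = _
  rw [zsmul_charGroup_apply, zsmul_charGroup_apply]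
  rfl

lemma eq_zero_of_forall_zsmul_torus {n : ℤ} (h : ∀ x : Torus, n • x = 0) : n = 0 := by
  by_contra hn
  have hn' : (n : ℝ) ≠ 0 := Int.cast_ne_zero.2 hn
  have h1 := h (((2 * n : ℝ)⁻¹ : ℝ) : Torus)
  rw [← AddCircle.coe_zsmul, AddCircle.coe_eq_zero_iff] at h1
  obtain ⟨k, hk⟩ := h1
  have h2 : (n : ℝ) * (2 * n : ℝ)⁻¹ = 1 / 2 := by field_simp
  rw [zsmul_eq_mul, zsmul_eq_mul, mul_one, h2] at hk
  have h3 : ((2 * k : ℤ) : ℝ) = (1 : ℤ) := by push_cast; linarith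
  have h4 : 2 * k = 1 := by exact_mod_cast h3
  omega

lemma torusChar_injective : Function.Injective torusChar := by
  rw [injective_iff_map_eq_zero]
  intro p hp
  have h (x : TwoTorus) : p.1 • x.1 + p.2 • x.2 = 0 := by
    rw [← torusChar_apply, hp]
    rfl
  exact Prod.ext (eq_zero_of_forall_zsmul_torus fun x => by simpa using h (x, 0))
    (eq_zero_of_forall_zsmul_torus fun x => by simpa using h (0, x))

instance isProbabilityMeasure_torus : IsProbabilityMeasure (volume : Measure Torus) :=
  ⟨by rw [AddCircle.measure_univ, ENNReal.ofReal_one]⟩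

lemma exists_torusChar_ne_zero {x : TwoTorus} (hx : x ≠ 0) : ∃ p, torusChar p x ≠ 0 := by
  by_contra! h
  exact hx (Prod.ext (by simpa using h (1, 0)) (by simpa using h (0, 1)))

lemma torusChar_surjective : Function.Surjective torusChar := fun y =>
  mem_of_separates ((volume : Measure Torus).prod volume) torusChar.range
    (fun _ hx => (exists_torusChar_ne_zero hx).imp' torusChar fun _ h => ⟨⟨_, rfl⟩, h⟩) y

/-- The product of `r ^ Q` with `Q` a quadratic form, and the function on `ℤ²` which
equals `1` on `2ℤ²` and `2` elsewhere. -/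
def twistedGaussian (Q : ℤ × ℤ → ℤ) (p : ℤ × ℤ) : ℝ :=
  (if Even p.1 ∧ Even p.2 then 1 else 2) * (1 / 1000 : ℝ) ^ Q p

lemma twistedGaussian_pos (Q : ℤ × ℤ → ℤ) (p : ℤ × ℤ) : 0 < twistedGaussian Q p := by
  unfold twistedGaussian
  split_ifs <;> positivity

lemma hasSum_pow_natAbs {t : ℝ} (h0 : 0 ≤ t) (h1 : t < 1) :
    HasSum (fun n : ℤ => t ^ n.natAbs) ((1 - t)⁻¹ + t * (1 - t)⁻¹) := by
  have h := hasSum_geometric_of_lt_one h0 h1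
  have h' := h.mul_left t
  simp only [← pow_succ'] at h'
  exact HasSum.of_nat_of_neg_add_one (f := fun n : ℤ => t ^ n.natAbs) h h'

lemma hasSum_pow_natAbs_mul_pow_natAbs {t : ℝ} (h0 : 0 ≤ t) (h1 : t < 1) :
    HasSum (fun p : ℤ × ℤ => t ^ p.1.natAbs * t ^ p.2.natAbs)
      (((1 - t)⁻¹ + t * (1 - t)⁻¹) * ((1 - t)⁻¹ + t * (1 - t)⁻¹)) := by
  have h := hasSum_pow_natAbs h0 h1
  have hs : Summable fun p : ℤ × ℤ => t ^ p.1.natAbs * t ^ p.2.natAbs :=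
    Summable.mul_of_nonneg (f := fun n : ℤ => t ^ n.natAbs) (g := fun n : ℤ => t ^ n.natAbs)
      h.summable h.summable (fun _ => pow_nonneg h0 _) (fun _ => pow_nonneg h0 _)
  exact HasSum.mul (f := fun n : ℤ => t ^ n.natAbs) (g := fun n : ℤ => t ^ n.natAbs) h h hs

lemma twistedGaussian_bound {Q : ℤ × ℤ → ℤ} (hQ0 : Q 0 = 0)
    (hQ : ∀ p : ℤ × ℤ, p.1 ^ 2 + p.2 ^ 2 ≤ 3 * Q p) :
    Summable (twistedGaussian Q) ∧ ∑' p, twistedGaussian Q p ≤ 2 := by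
  have h2 := hasSum_pow_natAbs_mul_pow_natAbs (t := 1 / 10) (by norm_num) (by norm_num)
  have h3 := (h2.mul_left 2).sub (hasSum_pi_single (0 : ℤ × ℤ) (1 : ℝ))
  have hle (p : ℤ × ℤ) : twistedGaussian Q p ≤
      2 * ((1 / 10 : ℝ) ^ p.1.natAbs * (1 / 10 : ℝ) ^ p.2.natAbs) -
        (Pi.single (0 : ℤ × ℤ) (1 : ℝ) : ℤ × ℤ → ℝ) p := by
    by_cases hp : p = 0
    · subst hp
      simp [twistedGaussian, hQ0]
      norm_num
    · have h4 : (1 / 1000 : ℝ) ^ Q p ≤ (1 / 10 : ℝ) ^ p.1.natAbs * (1 / 10 : ℝ) ^ p.2.natAbs := by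
        rw [← pow_add, ← zpow_natCast, show (1 / 1000 : ℝ) = (1 / 10) ^ (3 : ℤ) by norm_num,
          ← zpow_mul]
        refine zpow_le_zpow_right_of_le_one₀ (by norm_num) (by norm_num) ?_
        have ha (n : ℤ) : (n.natAbs : ℤ) ≤ n ^ 2 := by
          rw [← Int.natAbs_sq]
          exact_mod_cast Nat.le_self_pow two_ne_zero _
        push_cast [-Int.natCast_natAbs]
        linarith [hQ p, ha p.1, ha p.2]
      rw [Pi.single_eq_of_ne hp, sub_zero]
      unfold twistedGaussian
      have : (0 : ℝ) < (1 / 1000 : ℝ) ^ Q p := by positivity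
      split_ifs <;> linarith
  have hs : Summable (twistedGaussian Q) :=
    .of_nonneg_of_le (fun p => (twistedGaussian_pos Q p).le) hle h3.summable
  exact ⟨hs, (hasSum_le hle hs.hasSum h3).trans (by norm_num)⟩

lemma exists_measure_twistedGaussian {Q : ℤ × ℤ → ℤ} (hQ0 : Q 0 = 0)
    (hneg : ∀ p, Q (-p) = Q p) (hQ : ∀ p : ℤ × ℤ, p.1 ^ 2 + p.2 ^ 2 ≤ 3 * Q p) :
    ∃ μ : Measure TwoTorus, IsProbabilityMeasure μ ∧
      ∀ p, charFun' μ (torusChar p) = twistedGaussian Q p := by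
  obtain ⟨hs, hle⟩ := twistedGaussian_bound hQ0 hQ
  exact exists_probabilityMeasure_charFun'_eq ((volume : Measure Torus).prod volume)
    torusChar_injective (by simp [twistedGaussian, hQ0]) (fun p => (twistedGaussian_pos Q p).le)
    (fun p => by simp [twistedGaussian, hneg]) hs hle

lemma twistedGaussian_not_decomposable {Q : ℤ × ℤ → ℤ}
    (hQ : Q ((1, 0) + (1, 0)) = 4 * Q (1, 0)) {μ : Measure TwoTorus}
    (hμ : ∀ p, charFun' μ (torusChar p) = twistedGaussian Q p) :
    ¬ ∃ (γ ω : Measure TwoTorus), IsGaussianMeasure γ ∧ IsProbabilityMeasure ω ∧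
      ω {x : TwoTorus | x + x = 0} = 1 ∧ μ = γ ∗ ω := by
  rintro ⟨γ, ω, hγ, hprob, hω, rfl⟩
  have h := norm_charFun'_pow_four_le hγ hω (torusChar (1, 0))
  rw [← map_add, hμ, hμ, Complex.norm_real, Complex.norm_real,
    Real.norm_of_nonneg (twistedGaussian_pos Q _).le,
    Real.norm_of_nonneg (twistedGaussian_pos Q _).le] at h
  have h1 : twistedGaussian Q (1, 0) = 2 * (1 / 1000 : ℝ) ^ Q (1, 0) := by
    simp [twistedGaussian]
  have h2 : twistedGaussian Q ((1, 0) + (1, 0)) = ((1 / 1000 : ℝ) ^ Q (1, 0)) ^ 4 := by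
    rw [twistedGaussian, hQ, mul_comm 4, zpow_mul]
    norm_num [zpow_ofNat]
  rw [h1, h2, mul_pow] at h
  have : (0 : ℝ) < ((1 / 1000 : ℝ) ^ Q (1, 0)) ^ 4 := by positivity
  linarith

/-- The automorphism `(x, y) ↦ -(2x + y, x + y)` of the torus. -/
def torusAut : TwoTorus ≃+ TwoTorus where
  toFun x := (-(2 • x.1 + x.2), -(x.1 + x.2))
  invFun x := (x.2 - x.1, x.1 - 2 • x.2)
  left_inv x := by ext <;> dsimp only <;> abel
  right_inv x := by ext <;> dsimp only <;> abel
  map_add' x y := by ext <;> simp only [Prod.fst_add, Prod.snd_add] <;> abel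

lemma continuous_torusAut : Continuous torusAut :=
  show Continuous fun x : TwoTorus => (-(2 • x.1 + x.2), -(x.1 + x.2)) by fun_prop

lemma continuous_torusAut_symm : Continuous torusAut.symm :=
  show Continuous fun x : TwoTorus => (x.2 - x.1, x.1 - 2 • x.2) by fun_prop

/-- `torusAut` as a continuous endomorphism. -/
def torusAutHom : TwoTorus →ₜ+ TwoTorus := ⟨torusAut.toAddMonoidHom, continuous_torusAut⟩

lemma torusChar_comp_torusAutHom (q : ℤ × ℤ) :
    (torusChar q).comp torusAutHom = torusChar (-(2 * q.1 + q.2), -(q.1 + q.2)) := by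
  ext x
  change torusChar q (-(2 • x.1 + x.2), -(x.1 + x.2)) = _
  simp only [torusChar_apply]
  module

lemma torusChar_comp_neg_torusAutHom (q : ℤ × ℤ) :
    (torusChar q).comp (-torusAutHom) = torusChar (2 * q.1 + q.2, q.1 + q.2) := by
  ext x
  change torusChar q (-(-(2 • x.1 + x.2), -(x.1 + x.2))) = _
  simp only [torusChar_apply, Prod.fst_neg, Prod.snd_neg]
  module

end Torus

section Heyde

/-- The quadratic form `2n² + 2nm + m²`, given by the matrix of `-torusAut`. -/
def quadForm₁ (p : ℤ × ℤ) : ℤ := 2 * p.1 ^ 2 + 2 * p.1 * p.2 + p.2 ^ 2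

/-- The quadratic form `n² + m²`. -/
def quadForm₂ (p : ℤ × ℤ) : ℤ := p.1 ^ 2 + p.2 ^ 2

/-- The functional equation on `ℤ²` which expresses the symmetry of the conditional distribution. -/
lemma twistedGaussian_heyde (p q : ℤ × ℤ) :
    twistedGaussian quadForm₁ (p + q) *
        twistedGaussian quadForm₂ (p + (-(2 * q.1 + q.2), -(q.1 + q.2))) =
      twistedGaussian quadForm₁ (p + -q) *
        twistedGaussian quadForm₂ (p + (2 * q.1 + q.2, q.1 + q.2)) := by
  have hr : (1 / 1000 : ℝ) ≠ 0 := by norm_num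
  unfold twistedGaussian
  rw [mul_mul_mul_comm _ (_ ^ quadForm₁ (p + q)), mul_mul_mul_comm _ (_ ^ quadForm₁ (p + -q)),
    ← zpow_add₀ hr, ← zpow_add₀ hr]
  congr 1
  · simp only [Prod.fst_add, Prod.snd_add, Prod.fst_neg, Prod.snd_neg, Int.even_add, even_neg]
  · congr 1
    simp only [quadForm₁, quadForm₂, Prod.fst_add, Prod.snd_add, Prod.fst_neg, Prod.snd_neg]
    ring

lemma map_linearForms_symmetric {μ₁ μ₂ : Measure TwoTorus} [IsProbabilityMeasure μ₁]
    [IsProbabilityMeasure μ₂]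
    (h₁ : ∀ p, charFun' μ₁ (torusChar p) = twistedGaussian quadForm₁ p)
    (h₂ : ∀ p, charFun' μ₂ (torusChar p) = twistedGaussian quadForm₂ p) :
    (μ₁.prod μ₂).map (fun ω => (ω.1 + ω.2, ω.1 + torusAut ω.2)) =
      (μ₁.prod μ₂).map (fun ω => (ω.1 + ω.2, -(ω.1 + torusAut ω.2))) := by
  have hneg : (fun ω : TwoTorus × TwoTorus => (ω.1 + ω.2, -(ω.1 + torusAut ω.2))) =
      fun ω => (ω.1 + ω.2, (-ContinuousAddMonoidHom.id TwoTorus) ω.1 + (-torusAutHom) ω.2) := by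
    ext1 ω
    exact congrArg (Prod.mk _) (neg_add _ _)
  have hsep (x : TwoTorus × TwoTorus) (hx : x ≠ 0) : ∃ w : CharGroup (TwoTorus × TwoTorus),
      w x ≠ 0 := by
    by_contra! h
    refine hx (Prod.ext ?_ ?_) <;> by_contra hne <;>
      obtain ⟨p, hp⟩ := exists_torusChar_ne_zero hne
    · exact hp (h ((torusChar p).comp (.fst _ _)))
    · exact hp (h ((torusChar p).comp (.snd _ _)))
  rw [hneg]
  refine ext_of_charFun'_eq hsep fun w => ?_
  obtain ⟨p, hp⟩ := torusChar_surjective (w.comp (.inl _ _))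
  obtain ⟨q, hq⟩ := torusChar_surjective (w.comp (.inr _ _))
  have hqneg : (torusChar q).comp (-ContinuousAddMonoidHom.id TwoTorus) = torusChar (-q) := by
    rw [map_neg]
    ext x
    exact map_neg (torusChar q) x
  refine (charFun'_map_linearForms μ₁ μ₂ (.id _) torusAutHom w).trans
    (.trans ?_ (charFun'_map_linearForms μ₁ μ₂ (-.id _) (-torusAutHom) w).symm)
  have hqid : (torusChar q).comp (.id TwoTorus) = torusChar q := rfl
  rw [← hp, ← hq, hqid, hqneg, torusChar_comp_torusAutHom, torusChar_comp_neg_torusAutHom,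
    ← map_add, ← map_add, ← map_add, ← map_add, h₁, h₁, h₂, h₂]
  exact_mod_cast twistedGaussian_heyde p q

lemma eq_zero_of_add_torusAut_eq_zero (x : TwoTorus) (hx : x + torusAut x = 0) : x = 0 := by
  have h1 : x.1 + -(2 • x.1 + x.2) = 0 := congrArg Prod.fst hx
  have h2 : x.2 + -(x.1 + x.2) = 0 := congrArg Prod.snd hx
  have h3 : x.1 = 0 := by
    rw [← neg_eq_zero, ← h2]
    abel
  have h4 : x.2 = 0 := by simpa [h3] using h1
  exact Prod.ext h3 h4

end Heyde

/-- The Heyde theorem fails on the 2-dimensional torus: there are a topological automorphism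
`α` with `Ker(I+α) = {0}` and independent random variables with nonvanishing characteristic
functions such that the conditional distribution of `L₂ = ξ₁ + αξ₂` given `L₁ = ξ₁ + ξ₂` is
symmetric, while neither distribution is a convolution of a Gaussian distribution and a
distribution supported in `G = {x : x + x = 0}`. -/
theorem heyde_fails_on_two_torus :
    ∃ (α : TwoTorus ≃+ TwoTorus), Continuous α ∧ Continuous α.symm ∧
      (∀ x : TwoTorus, x + α x = 0 → x = 0) ∧
      ∃ (Ω : Type) (_ : MeasureSpace Ω) (ξ₁ ξ₂ : Ω → TwoTorus) (μ₁ μ₂ : Measure TwoTorus),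
        IsProbabilityMeasure (volume : Measure Ω) ∧
        Measurable ξ₁ ∧ Measurable ξ₂ ∧ IndepFun ξ₁ ξ₂ volume ∧
        volume.map ξ₁ = μ₁ ∧ volume.map ξ₂ = μ₂ ∧
        (∀ y : CharGroup TwoTorus, charFun' μ₁ y ≠ 0) ∧
        (∀ y : CharGroup TwoTorus, charFun' μ₂ y ≠ 0) ∧
        volume.map (fun ω => (ξ₁ ω + ξ₂ ω, ξ₁ ω + α (ξ₂ ω)))
          = volume.map (fun ω => (ξ₁ ω + ξ₂ ω, -(ξ₁ ω + α (ξ₂ ω)))) ∧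
        (¬ ∃ (γ ω : Measure TwoTorus), IsGaussianMeasure γ ∧ IsProbabilityMeasure ω ∧
            ω {x : TwoTorus | x + x = 0} = 1 ∧ μ₁ = γ ∗ ω) ∧
        (¬ ∃ (γ ω : Measure TwoTorus), IsGaussianMeasure γ ∧ IsProbabilityMeasure ω ∧
            ω {x : TwoTorus | x + x = 0} = 1 ∧ μ₂ = γ ∗ ω) := by
  obtain ⟨μ₁, hμ₁, h₁⟩ := exists_measure_twistedGaussian (Q := quadForm₁) rfl
    (fun p => by simp [quadForm₁]) fun p => by
      unfold quadForm₁
      nlinarith [sq_nonneg (5 * p.1 + 3 * p.2), sq_nonneg p.2]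
  obtain ⟨μ₂, hμ₂, h₂⟩ := exists_measure_twistedGaussian (Q := quadForm₂) rfl
    (fun p => by simp [quadForm₂]) fun p => by
      unfold quadForm₂
      nlinarith [sq_nonneg p.1, sq_nonneg p.2]
  refine ⟨torusAut, continuous_torusAut, continuous_torusAut_symm, eq_zero_of_add_torusAut_eq_zero,
    TwoTorus × TwoTorus, ⟨μ₁.prod μ₂⟩, Prod.fst, Prod.snd, μ₁, μ₂,
    inferInstanceAs (IsProbabilityMeasure (μ₁.prod μ₂)), measurable_fst, measurable_snd, ?_,
    Measure.fst_prod, Measure.snd_prod, fun y => ?_, fun y => ?_, map_linearForms_symmetric h₁ h₂,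
    twistedGaussian_not_decomposable rfl h₁, twistedGaussian_not_decomposable rfl h₂⟩
  · exact indepFun_prod (μ := μ₁) (ν := μ₂) measurable_id measurable_id
  · obtain ⟨p, rfl⟩ := torusChar_surjective y
    rw [h₁]
    exact_mod_cast (twistedGaussian_pos quadForm₁ p).ne'
  · obtain ⟨p, rfl⟩ := torusChar_surjective y
    rw [h₂]
    exact_mod_cast (twistedGaussian_pos quadForm₂ p).ne'
end
end

section
/- Let a, b, c, d be integers with ad − bc = 1 and a + d < −2, and let M be the 2×2 real matrix with rows (a, c) and (b, d) (the transpose of the matrix with rows (a, b) and (c, d)). Then there exist symmetric positive semidefinite real 2×2 matrices A₁ and A₂ such that det A₁ = det A₂ > 0 and A₁ + A₂·M = 0. -/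
open Matrix

/-- A real symmetric `2×2` matrix with positive upper-left entry and positive determinant is
positive semidefinite. -/
theorem posSemidef_fin_two_of_pos {p q r : ℝ} (hp : 0 < p) (hdet : 0 < p * r - q * q) :
    (Matrix.of ![![p, q], ![q, r]]).PosSemidef := by
  refine Matrix.PosSemidef.of_dotProduct_mulVec_nonneg ?_ fun v => ?_
  · ext i j
    fin_cases i <;> fin_cases j <;> simp
  · simp only [dotProduct, mulVec, Fin.sum_univ_two, Matrix.of_apply, Matrix.cons_val_zero,
      Matrix.cons_val_one, Pi.star_apply, star_trivial]
    refine nonneg_of_mul_nonneg_right ?_ hp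
    calc (0 : ℝ) ≤ (p * v 0 + q * v 1) ^ 2 + (p * r - q * q) * v 1 ^ 2 := by positivity
      _ = _ := by ring

/-- For a `2×2` integer matrix with `ad − bc = 1` and `a + d < −2`, there exist symmetric
positive semidefinite matrices `A₁`, `A₂` with equal positive determinants such that
`A₁ + A₂·α̃ = 0`, where `α̃` is the transpose of the matrix with rows `(a,b)` and `(c,d)`. -/
theorem exists_psd_matrices_of_trace_lt_neg_two
    (a b c d : ℤ) (hdet : a * d - b * c = 1) (htr : a + d < -2) :
    ∃ A₁ A₂ : Matrix (Fin 2) (Fin 2) ℝ,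
      A₁.PosSemidef ∧ A₂.PosSemidef ∧
      A₁.det = A₂.det ∧ 0 < A₁.det ∧
      A₁ + A₂ * Matrix.of ![![(a : ℝ), (c : ℝ)], ![(b : ℝ), (d : ℝ)]] = 0 := by
  have hb : b ≠ 0 := by
    rintro rfl
    have had : a * d = 1 := by linarith
    rcases Int.mul_eq_one_iff_eq_one_or_neg_one.mp had with ⟨rfl, rfl⟩ | ⟨rfl, rfl⟩ <;> omega
  have hb' : (0 : ℝ) < (b : ℝ) ^ 2 := by positivity
  have hdet' : (a : ℝ) * d - b * c = 1 := by exact_mod_cast hdet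
  have htr' : (a : ℝ) + d < -2 := by exact_mod_cast htr
  generalize (a : ℝ) = a, (b : ℝ) = b, (c : ℝ) = c, (d : ℝ) = d at *
  -- `A₂` is the sum of `uᵀ u` over the left eigenvectors `u = (b, μ - a)` of the matrix.
  have hpos : 0 < b ^ 2 * ((a + d) ^ 2 - 4) := mul_pos hb' (by nlinarith)
  have h₂ : 2 * b ^ 2 * ((d - a) ^ 2 + 2 * b * c) - b * (d - a) * (b * (d - a))
      = b ^ 2 * ((a + d) ^ 2 - 4) := by
    linear_combination (-4 * b ^ 2) * hdet'
  have h₁ : -(b ^ 2 * (a + d)) * -(b * (d - a) * c + ((d - a) ^ 2 + 2 * b * c) * d)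
      - -(2 * b ^ 2 * c + b * (d - a) * d) * -(2 * b ^ 2 * c + b * (d - a) * d)
      = b ^ 2 * ((a + d) ^ 2 - 4) := by
    linear_combination (b ^ 2 * ((d - a) ^ 2 + 4 * b * c) - 4 * b ^ 2) * hdet'
  refine ⟨Matrix.of ![![-(b ^ 2 * (a + d)), -(2 * b ^ 2 * c + b * (d - a) * d)],
      ![-(2 * b ^ 2 * c + b * (d - a) * d),
        -(b * (d - a) * c + ((d - a) ^ 2 + 2 * b * c) * d)]],
    Matrix.of ![![2 * b ^ 2, b * (d - a)], ![b * (d - a), (d - a) ^ 2 + 2 * b * c]],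
    posSemidef_fin_two_of_pos (by nlinarith) (h₁ ▸ hpos),
    posSemidef_fin_two_of_pos (by positivity) (h₂ ▸ hpos), ?_, ?_, ?_⟩
  · rw [det_fin_two_of, det_fin_two_of, h₁, h₂]
  · rw [det_fin_two_of, h₁]
    exact hpos
  · ext i j
    fin_cases i <;> fin_cases j <;> simp <;> ring
end
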